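/- Let μ ∈ ℝ^p, let Σ and Σ' be p×p positive definite matrices, and let q_1, q_2 ∈ ℝ satisfy q_1² + q_2² = 1. Let X ~ N_p(μ, Σ) and W ~ N_p(0, Σ') be independent, and define X^(1) = q_1 X + q_2 W and X^(2) = q_2 X − q_1 W. Set M = q_1² Σ + (1 − q_1²) Σ'. Then: (i) X^(1) ~ N_p(q_1 μ, M); and (ii) the residual R = X^(2) − q_1 q_2 (Σ − Σ') M^{−1} (X^(1) − q_1 μ) is independent of X^(1) and has distribution N_p(q_2 μ, q_2² Σ + (1 − q_2²) Σ' − q_1² q_2² (Σ − Σ') M^{−1} (Σ − Σ')). -/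

import Mathlib

open MeasureTheory ProbabilityTheory Matrix BigOperators

noncomputable section

/-- A measure `ν` on `ι → ℝ` is the multivariate Gaussian distribution with mean vector `m` and
covariance matrix `S` if every linear functional pushes `ν` forward to the one-dimensional
Gaussian distribution with the corresponding mean and variance (Cramér–Wold characterization). -/
def IsGaussianVec {ι : Type*} [Fintype ι] (ν : Measure (ι → ℝ)) (m : ι → ℝ)
    (S : Matrix ι ι ℝ) : Prop :=
  ∀ l : ι → ℝ,
    ν.map (fun x => ∑ i, l i * x i) =
      gaussianReal (∑ i, l i * m i) (∑ i, ∑ j, l i * S i j * l j).toNNReal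

namespace IsGaussianVec

variable {Ω ι κ : Type*} [MeasurableSpace Ω] [Fintype ι] [Fintype κ] {P : Measure Ω}
  {X Y : Ω → ι → ℝ} {m m' : ι → ℝ} {S S' : Matrix ι ι ℝ}

lemma iff_hasLaw_dotProduct (hX : Measurable X) :
    IsGaussianVec (P.map X) m S ↔
      ∀ l : ι → ℝ, HasLaw (fun ω => l ⬝ᵥ X ω)
        (gaussianReal (l ⬝ᵥ m) (l ⬝ᵥ S *ᵥ l).toNNReal) P := by
  have hquad (l : ι → ℝ) : ∑ i, ∑ j, l i * S i j * l j = l ⬝ᵥ S *ᵥ l := by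
    simp only [dotProduct, mulVec, Finset.mul_sum, mul_assoc]
  have hmeas (l : ι → ℝ) : Measurable fun x : ι → ℝ => ∑ i, l i * x i := by fun_prop
  refine forall_congr' fun l => ?_
  rw [hquad, Measure.map_map (hmeas l) hX]
  exact ⟨fun h => ⟨((hmeas l).comp hX).aemeasurable, h⟩, fun h => h.map_eq⟩

lemma hasGaussianLaw (h : IsGaussianVec (P.map X) m S) :
    HasGaussianLaw X P where
  isGaussian_map := by
    classical
    refine isGaussian_of_map_eq_gaussianReal fun L => ?_
    have hL : (L : (ι → ℝ) → ℝ) = fun x => ∑ i, L (Pi.single i 1) * x i := by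
      ext x
      conv_lhs => rw [pi_eq_sum_univ' x]
      simp [mul_comm]
    rw [hL]
    exact ⟨_, _, h _⟩

lemma memLp_dotProduct (hX : Measurable X) (h : IsGaussianVec (P.map X) m S) (l : ι → ℝ) :
    MemLp (fun ω => l ⬝ᵥ X ω) 2 P :=
  ((iff_hasLaw_dotProduct hX).1 h l).hasGaussianLaw.memLp_two

lemma variance_dotProduct (hX : Measurable X) (hS : S.PosSemidef)
    (h : IsGaussianVec (P.map X) m S) (l : ι → ℝ) :
    Var[fun ω => l ⬝ᵥ X ω; P] = l ⬝ᵥ S *ᵥ l := by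
  rw [((iff_hasLaw_dotProduct hX).1 h l).variance_eq, variance_id_gaussianReal,
    Real.coe_toNNReal _ (by simpa using hS.dotProduct_mulVec_nonneg l)]

lemma covariance_dotProduct [IsProbabilityMeasure P] (hX : Measurable X) (hS : S.PosSemidef)
    (h : IsGaussianVec (P.map X) m S) (k l : ι → ℝ) :
    cov[fun ω => k ⬝ᵥ X ω, fun ω => l ⬝ᵥ X ω; P] = k ⬝ᵥ S *ᵥ l := by
  have hadd := variance_add (memLp_dotProduct hX h k) (memLp_dotProduct hX h l)
  have hsum : (fun ω => k ⬝ᵥ X ω) + (fun ω => l ⬝ᵥ X ω) = fun ω => (k + l) ⬝ᵥ X ω := by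
    ext ω; simp [add_dotProduct]
  have hsymm : l ⬝ᵥ S *ᵥ k = k ⬝ᵥ S *ᵥ l := by
    have hT : Sᵀ = S := by simpa using hS.isHermitian.eq
    rw [dotProduct_mulVec, ← mulVec_transpose, hT, dotProduct_comm]
  rw [hsum, variance_dotProduct hX hS h, variance_dotProduct hX hS h,
    variance_dotProduct hX hS h, mulVec_add, dotProduct_add, add_dotProduct, add_dotProduct,
    hsymm] at hadd
  linarith

/-- An affine combination of two independent Gaussian vectors is a Gaussian vector. -/
lemma map_affine_combination (hX : Measurable X) (hY : Measurable Y)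
    (hS : S.PosSemidef) (hS' : S'.PosSemidef)
    (hXg : IsGaussianVec (P.map X) m S) (hYg : IsGaussianVec (P.map Y) m' S')
    (hXY : IndepFun X Y P) (A B : Matrix κ ι ℝ) (c : κ → ℝ) :
    IsGaussianVec (P.map fun ω => A *ᵥ X ω + B *ᵥ Y ω + c) (A *ᵥ m + B *ᵥ m' + c)
      (A * S * Aᵀ + B * S' * Bᵀ) := by
  refine (iff_hasLaw_dotProduct (by fun_prop)).2 fun l => ?_
  have hXl := (iff_hasLaw_dotProduct hX).1 hXg (l ᵥ* A)
  have hYl := (iff_hasLaw_dotProduct hY).1 hYg (l ᵥ* B)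
  have hind : IndepFun (fun ω => l ᵥ* A ⬝ᵥ X ω) (fun ω => l ᵥ* B ⬝ᵥ Y ω) P :=
    hXY.comp (φ := fun x => l ᵥ* A ⬝ᵥ x) (ψ := fun y => l ᵥ* B ⬝ᵥ y) (by fun_prop) (by fun_prop)
  have hsum : HasLaw (fun ω => l ᵥ* A ⬝ᵥ X ω + l ᵥ* B ⬝ᵥ Y ω) _ P :=
    ⟨hXl.aemeasurable.add hYl.aemeasurable,
      gaussianReal_add_gaussianReal_of_indepFun hind hXl.map_eq hYl.map_eq⟩
  convert! gaussianReal_add_const hsum (l ⬝ᵥ c) using 2 with ω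
  · simp [dotProduct_add, dotProduct_mulVec]
  · simp [dotProduct_add, dotProduct_mulVec]
  · rw [← Real.toNNReal_add (by simpa using hS.dotProduct_mulVec_nonneg (l ᵥ* A))
      (by simpa using hS'.dotProduct_mulVec_nonneg (l ᵥ* B))]
    simp only [add_mulVec, dotProduct_add, ← mulVec_mulVec, mulVec_transpose, dotProduct_mulVec]

/-- Two affine combinations of a pair of independent Gaussian vectors are independent as soon as
their cross-covariance matrix vanishes. -/
lemma indepFun_affine_combination [IsProbabilityMeasure P] (hX : Measurable X) (hY : Measurable Y)
    (hS : S.PosSemidef) (hS' : S'.PosSemidef)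
    (hXg : IsGaussianVec (P.map X) m S) (hYg : IsGaussianVec (P.map Y) m' S')
    (hXY : IndepFun X Y P) {A B C D : Matrix κ ι ℝ} (hcov : A * S * Cᵀ + B * S' * Dᵀ = 0)
    (c d : κ → ℝ) :
    IndepFun (fun ω => A *ᵥ X ω + B *ᵥ Y ω + c) (fun ω => C *ᵥ X ω + D *ᵥ Y ω + d) P := by
  have hjoint : HasGaussianLaw
      (fun ω => (A *ᵥ X ω + B *ᵥ Y ω, C *ᵥ X ω + D *ᵥ Y ω)) P := by
    have hpair := hXY.hasGaussianLaw (hasGaussianLaw hXg) (hasGaussianLaw hYg)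
    let L : (ι → ℝ) × (ι → ℝ) →ₗ[ℝ] (κ → ℝ) × (κ → ℝ) :=
      (A.mulVecLin.coprod B.mulVecLin).prod (C.mulVecLin.coprod D.mulVecLin)
    simpa [L] using hpair.map_fun L.toContinuousLinearMap
  have hind : IndepFun (fun ω => A *ᵥ X ω + B *ᵥ Y ω) (fun ω => C *ᵥ X ω + D *ᵥ Y ω) P := by
    refine HasGaussianLaw.indepFun_of_covariance_eval
      (X := fun i ω => (A *ᵥ X ω + B *ᵥ Y ω) i) (Y := fun i ω => (C *ᵥ X ω + D *ᵥ Y ω) i)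
      hjoint fun i j => ?_
    have hXL := memLp_dotProduct hX hXg
    have hYL := memLp_dotProduct hY hYg
    have hcross (k l : ι → ℝ) : cov[fun ω => k ⬝ᵥ X ω, fun ω => l ⬝ᵥ Y ω; P] = 0 :=
      IndepFun.covariance_eq_zero
        (hXY.comp (φ := fun x => k ⬝ᵥ x) (ψ := fun y => l ⬝ᵥ y) (by fun_prop) (by fun_prop))
        (hXL k) (hYL l)
    change cov[(fun ω => A i ⬝ᵥ X ω) + (fun ω => B i ⬝ᵥ Y ω),
      (fun ω => C j ⬝ᵥ X ω) + (fun ω => D j ⬝ᵥ Y ω); P] = 0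
    rw [covariance_add_left (hXL _) (hYL _) ((hXL _).add (hYL _)),
      covariance_add_right (hXL _) (hXL _) (hYL _), covariance_add_right (hYL _) (hXL _) (hYL _),
      hcross, covariance_comm (fun ω => B i ⬝ᵥ Y ω), hcross,
      covariance_dotProduct hX hS hXg, covariance_dotProduct hY hS' hYg, add_zero, zero_add]
    have hij := congrFun₂ hcov i j
    rw [Matrix.mul_assoc, Matrix.mul_assoc] at hij
    exact hij
  exact hind.comp (φ := fun x => x + c) (ψ := fun x => x + d) (by fun_prop) (by fun_prop)

end IsGaussianVec

/-- Remark 8: with `X ~ N_p(μ, S)` and `W ~ N_p(0, S')` independent, `q₁² + q₂² = 1`,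
`X⁽¹⁾ = q₁ X + q₂ W`, `X⁽²⁾ = q₂ X − q₁ W`, and `M = q₁² S + (1 − q₁²) S'`:
(i) `X⁽¹⁾ ~ N_p(q₁ μ, M)`; (ii) the residual
`R = X⁽²⁾ − q₁ q₂ (S − S') M⁻¹ (X⁽¹⁾ − q₁ μ)` is independent of `X⁽¹⁾` and
`R ~ N_p(q₂ μ, q₂² S + (1 − q₂²) S' − q₁² q₂² (S − S') M⁻¹ (S − S'))`. -/
theorem gaussian_fission_marginal_and_conditional
    {Ω : Type*} [MeasurableSpace Ω] (P : Measure Ω) [IsProbabilityMeasure P]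
    (p : ℕ) (μ : Fin p → ℝ) (S S' : Matrix (Fin p) (Fin p) ℝ)
    (hS : S.PosDef) (hS' : S'.PosDef)
    (q1 q2 : ℝ) (hq : q1 ^ 2 + q2 ^ 2 = 1)
    (X W : Ω → Fin p → ℝ) (hXm : Measurable X) (hWm : Measurable W)
    (hX : IsGaussianVec (P.map X) μ S)
    (hW : IsGaussianVec (P.map W) (fun _ => 0) S')
    (hindep : IndepFun X W P)
    (X1 X2 : Ω → Fin p → ℝ)
    (hX1 : ∀ ω i, X1 ω i = q1 * X ω i + q2 * W ω i)
    (hX2 : ∀ ω i, X2 ω i = q2 * X ω i - q1 * W ω i)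
    (M : Matrix (Fin p) (Fin p) ℝ) (hM : M = q1 ^ 2 • S + (1 - q1 ^ 2) • S')
    (R : Ω → Fin p → ℝ)
    (hR : ∀ ω, R ω =
      X2 ω - (q1 * q2) • ((S - S') * M⁻¹).mulVec (X1 ω - q1 • μ)) :
    IsGaussianVec (P.map X1) (q1 • μ) M ∧
      IndepFun R X1 P ∧
      IsGaussianVec (P.map R) (q2 • μ)
        (q2 ^ 2 • S + (1 - q2 ^ 2) • S' -
          (q1 ^ 2 * q2 ^ 2) • ((S - S') * M⁻¹ * (S - S'))) := by
  have hq2 : q2 ^ 2 = 1 - q1 ^ 2 := by linarith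
  have hMpos : M.PosDef := by
    rw [hM, ← hq2]
    rcases eq_or_ne q1 0 with rfl | h1
    · have : q2 ^ 2 = 1 := by linarith
      simpa [this] using hS'
    · exact (hS.smul (by positivity)).add_posSemidef (hS'.posSemidef.smul (by positivity))
  have hMM : M⁻¹ * M = 1 := nonsing_inv_mul M ((isUnit_iff_isUnit_det M).1 hMpos.isUnit)
  rw [← hq2] at hM
  set K := (q1 * q2) • ((S - S') * M⁻¹) with hK
  have hKM : K * M = (q1 * q2) • (S - S') := by
    rw [hK, Matrix.smul_mul, Matrix.mul_assoc, hMM, Matrix.mul_one]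
  have hX1' : X1 = fun ω =>
      (q1 • 1 : Matrix (Fin p) (Fin p) ℝ) *ᵥ X ω + (q2 • 1 : Matrix (Fin p) (Fin p) ℝ) *ᵥ W ω
        + 0 := by
    ext ω i
    simp [hX1, smul_mulVec]
  have hR' : R = fun ω => (q2 • 1 - q1 • K) *ᵥ X ω + (-(q1 • 1) - q2 • K) *ᵥ W ω
      + q1 • K *ᵥ μ := by
    ext1 ω
    have h1 : X1 ω = q1 • X ω + q2 • W ω := by ext i; simp [hX1]
    have h2 : X2 ω = q2 • X ω - q1 • W ω := by ext i; simp [hX2]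
    rw [hR, h1, h2, ← smul_mulVec, ← hK]
    simp only [mulVec_sub, mulVec_add, mulVec_smul, sub_mulVec, neg_mulVec, smul_mulVec,
      one_mulVec]
    abel
  have hSp := hS.posSemidef
  have hSp' := hS'.posSemidef
  have hKS : q1 ^ 2 • (K * S) + q2 ^ 2 • (K * S') = (q1 * q2) • (S - S') := by
    rw [← hKM, hM, Matrix.mul_add, Matrix.mul_smul, Matrix.mul_smul]
  have hgauss (A B : Matrix (Fin p) (Fin p) ℝ) (c : Fin p → ℝ) :=
    IsGaussianVec.map_affine_combination hXm hWm hSp hSp' hX hW hindep A B c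
  rw [hX1', hR']
  refine ⟨?_, ?_, ?_⟩
  · convert! hgauss (q1 • 1) (q2 • 1) 0 using 1
    · change _ = _ + _ *ᵥ (0 : Fin p → ℝ) + _
      simp [smul_mulVec]
    · simp [hM, smul_smul, pow_two]
  · refine IsGaussianVec.indepFun_affine_combination hXm hWm hSp hSp' hX hW hindep ?_ _ _
    simp only [transpose_smul, transpose_one, Matrix.mul_smul, Matrix.mul_one, Matrix.sub_mul,
      Matrix.neg_mul, Matrix.smul_mul, Matrix.one_mul]
    linear_combination (norm := module) -hKS
  · convert! hgauss (q2 • 1 - q1 • K) (-(q1 • 1) - q2 • K) (q1 • K *ᵥ μ) using 1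
    · change _ = _ + _ *ᵥ (0 : Fin p → ℝ) + _
      simp [sub_mulVec, smul_mulVec]
    · have hKT := congrArg (· * Kᵀ) hKS
      have hKd : K * S - K * S' = (q1 * q2) • ((S - S') * M⁻¹ * (S - S')) := by
        rw [← Matrix.mul_sub, hK, Matrix.smul_mul]
      have hS'q : (1 - q2 ^ 2) • S' = q1 ^ 2 • S' := by rw [hq2, sub_sub_cancel]
      simp only [Matrix.add_mul, Matrix.sub_mul, Matrix.smul_mul] at hKT
      simp only [transpose_sub, transpose_neg, transpose_smul, transpose_one, Matrix.mul_smul,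
        Matrix.mul_one, Matrix.sub_mul, Matrix.mul_sub, Matrix.neg_mul, Matrix.mul_neg,
        Matrix.smul_mul, Matrix.one_mul] at hKd ⊢
      linear_combination (norm := module) hS'q - hKT + (q1 * q2) • hKd
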